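/- MacMahon's formula: ∑_{π ∈ P} s^{|π|} = ∏_{n=1}^{∞} (1 / (1 - s^n))^n, where the sum is over all plane partitions, as an identity of formal power series in s (equivalently, for real 0 ≤ s < 1). -/

import Mathlib

open scoped BigOperators

/-- A plane partition: a filling of a Young diagram (its support) with positive
integers that are weakly decreasing along rows and columns.  Entries outside
the support are recorded as `0`, and rows and columns are indexed from `0`
(so box `(i, j)` is box `(i+1, j+1)` in the 1-indexed convention). -/
structure PlanePartition where
  part : ℕ → ℕ → ℕ
  row_decr : ∀ i j, part i (j + 1) ≤ part i j
  col_decr : ∀ i j, part (i + 1) j ≤ part i j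
  finite_supp : {p : ℕ × ℕ | part p.1 p.2 ≠ 0}.Finite

namespace PlanePartition

/-- The weight `|π|`: the sum of all entries of `π`. -/
noncomputable def weight (π : PlanePartition) : ℕ := ∑ᶠ p : ℕ × ℕ, π.part p.1 p.2

/-- The trace `tr(π)`: the sum of the diagonal entries of `π`. -/
noncomputable def trace (π : PlanePartition) : ℕ := ∑ᶠ i : ℕ, π.part i i

/-- A strict plane partition: all of the diagonal partitions of `π` have
distinct parts, i.e. every diagonal of `π` is strictly decreasing where
nonzero. -/
def IsStrict (π : PlanePartition) : Prop :=
  ∀ i j, π.part i j ≠ 0 → π.part (i + 1) (j + 1) < π.part i j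

end PlanePartition

/-- Two boxes of `ℕ × ℕ` are adjacent when they share an edge. -/
def Adjacent (p q : ℕ × ℕ) : Prop :=
  (p.1 = q.1 ∧ (p.2 + 1 = q.2 ∨ q.2 + 1 = p.2)) ∨
  (p.2 = q.2 ∧ (p.1 + 1 = q.1 ∨ q.1 + 1 = p.1))

/-- One step of connectivity for a filling `g` of boxes by natural numbers:
adjacent boxes carrying the same nonzero entry. -/
def ConnStep (g : ℕ → ℕ → ℕ) (p q : ℕ × ℕ) : Prop :=
  Adjacent p q ∧ g p.1 p.2 = g q.1 q.2 ∧ g p.1 p.2 ≠ 0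

/-- `p` and `q` belong to the same connected component of `g`: both are boxes
of the support and they are joined by a chain of adjacent boxes all filled
with the same number. -/
def SameComponent (g : ℕ → ℕ → ℕ) (p q : ℕ × ℕ) : Prop :=
  g p.1 p.2 ≠ 0 ∧ Relation.ReflTransGen (ConnStep g) p q

/-- The set of connected components of a filling `g`. -/
def components (g : ℕ → ℕ → ℕ) : Set (Set (ℕ × ℕ)) :=
  {C | ∃ p : ℕ × ℕ, g p.1 p.2 ≠ 0 ∧ C = {q | SameComponent g p q}}

/-- `k(g)`: the number of connected components. -/
noncomputable def numComponents (g : ℕ → ℕ → ℕ) : ℕ := (components g).ncard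

/-- The level `h(p)` of a box `p`: the smallest positive `h` such that the box
shifted diagonally by `h` does not belong to the same connected component. -/
noncomputable def level (g : ℕ → ℕ → ℕ) (p : ℕ × ℕ) : ℕ :=
  sInf {h : ℕ | 0 < h ∧ ¬ SameComponent g p (p.1 + h, p.2 + h)}

/-- One step of border connectivity: adjacent boxes with the same nonzero
entry and the same level. -/
def BorderStep (g : ℕ → ℕ → ℕ) (p q : ℕ × ℕ) : Prop :=
  ConnStep g p q ∧ level g p = level g q

/-- `p` and `q` belong to the same border component. -/
def SameBorder (g : ℕ → ℕ → ℕ) (p q : ℕ × ℕ) : Prop :=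
  g p.1 p.2 ≠ 0 ∧ Relation.ReflTransGen (BorderStep g) p q

/-- The set of border components of a filling `g` (each border component is a
maximal connected set of boxes with the same entry and the same level). -/
def borderComponents (g : ℕ → ℕ → ℕ) : Set (Set (ℕ × ℕ)) :=
  {B | ∃ p : ℕ × ℕ, g p.1 p.2 ≠ 0 ∧ B = {q | SameBorder g p q}}

/-- The (common) level of the boxes of a border component `B`. -/
noncomputable def borderLevel (g : ℕ → ℕ → ℕ) (B : Set (ℕ × ℕ)) : ℕ :=
  sInf {h : ℕ | ∃ p ∈ B, level g p = h}

/-- The polynomial `A_π(t)`: the product over all border components `B` of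
`π` of `(1 - t ^ level(B))`; equivalently the product over connected
components `C` of `P_C(t) = ∏_i (1 - t^i)^{n_i}` where `n_i` is the number of
`i`-level border components of `C`. -/
noncomputable def Apoly (t : ℝ) (π : PlanePartition) : ℝ :=
  ∏ᶠ B ∈ borderComponents π.part, (1 - t ^ borderLevel π.part B)

/-- The function `f(n, m)` (for parameters `q`, `t`); the empty product gives
`f(0, m) = 1`. -/
noncomputable def fmac (q t : ℝ) (n m : ℕ) : ℝ :=
  ∏ i ∈ Finset.range n, (1 - q ^ i * t ^ (m + 1)) / (1 - q ^ (i + 1) * t ^ m)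

/-- `F_π(i,j)(q,t)`, associated to the box `(i, j)` of `π`: with
`λ = (π(i,j), π(i+1,j+1), …)`, `μ = (π(i+1,j), π(i+2,j+1), …)` and
`ν = (π(i,j+1), π(i+1,j+2), …)`, this is
`∏_{m ≥ 0} f(λ₁-μ_{m+1},m) f(λ₁-ν_{m+1},m) / (f(λ₁-λ_{m+1},m) f(λ₁-λ_{m+2},m))`
(only finitely many factors differ from `1`). -/
noncomputable def Fbox (q t : ℝ) (π : PlanePartition) (i j : ℕ) : ℝ :=
  ∏' m : ℕ,
    (fmac q t (π.part i j - π.part (i + 1 + m) (j + m)) m *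
        fmac q t (π.part i j - π.part (i + m) (j + 1 + m)) m) /
      (fmac q t (π.part i j - π.part (i + m) (j + m)) m *
        fmac q t (π.part i j - π.part (i + m + 1) (j + m + 1)) m)

/-- `F_π(q,t)`: the product of `F_π(i,j)(q,t)` over all boxes `(i,j)` of the
support of `π`. -/
noncomputable def Fmac (q t : ℝ) (π : PlanePartition) : ℝ :=
  ∏ᶠ p : ℕ × ℕ, if π.part p.1 p.2 ≠ 0 then Fbox q t π p.1 p.2 else 1

/-- The infinite `q`-Pochhammer symbol `(x; q)_∞ = ∏_{n ≥ 0} (1 - x qⁿ)`. -/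
noncomputable def qPoch (x q : ℝ) : ℝ := ∏' n : ℕ, (1 - x * q ^ n)


section MacMahon

open scoped ENNReal

/-- `l` and `m` interlace: `l 0 ≥ m 0 ≥ l 1 ≥ m 1 ≥ ⋯`. -/
def Interlaces (l m : ℕ →₀ ℕ) : Prop := ∀ i, m i ≤ l i ∧ l (i + 1) ≤ m i

theorem Interlaces.degree_le {l m : ℕ →₀ ℕ} (h : Interlaces l m) : m.degree ≤ l.degree :=
  Finsupp.degree_mono fun i => (h i).1

theorem Interlaces.eq_zero {m : ℕ →₀ ℕ} (h : Interlaces 0 m) : m = 0 := by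
  ext i
  simpa using (h i).1

open Classical in
/-- The indicator of the interlacing relation. -/
noncomputable def interlaceInd (l m : ℕ →₀ ℕ) : ℝ≥0∞ := if Interlaces l m then 1 else 0

theorem interlaceInd_of {l m : ℕ →₀ ℕ} (h : Interlaces l m) : interlaceInd l m = 1 := if_pos h

theorem interlaceInd_of_not {l m : ℕ →₀ ℕ} (h : ¬ Interlaces l m) : interlaceInd l m = 0 := if_neg h

theorem Finsupp.degree_eq_sum_range {f : ℕ →₀ ℕ} {B : ℕ} (h : f.support ⊆ Finset.range B) :
    f.degree = ∑ i ∈ Finset.range B, f i := by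
  rw [Finsupp.degree_apply]
  exact Finset.sum_subset h fun i _ hi => Finsupp.notMem_support_iff.1 hi

/-- The partition `l` above both `m` and `v` that corresponds to `k` below both and `n`. -/
noncomputable def toggleUp (m v : ℕ →₀ ℕ) (n : ℕ) (k : ℕ →₀ ℕ) : ℕ →₀ ℕ :=
  Finsupp.onFinset (insert 0 (m.support.image Nat.succ))
    (fun i => match i with
      | 0 => max (m 0) (v 0) + n
      | i + 1 => min (max (m (i + 1)) (v (i + 1)) + min (m i) (v i) - k i) (m i)) (by
    rintro (_ | i) hi
    · simp
    · have : m i ≠ 0 := by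
        intro h
        simp [h] at hi
      simp [this])

theorem toggleUp_zero (m v : ℕ →₀ ℕ) (n : ℕ) (k : ℕ →₀ ℕ) :
    toggleUp m v n k 0 = max (m 0) (v 0) + n := rfl

theorem toggleUp_succ (m v : ℕ →₀ ℕ) (n : ℕ) (k : ℕ →₀ ℕ) (i : ℕ) :
    toggleUp m v n k (i + 1) =
      min (max (m (i + 1)) (v (i + 1)) + min (m i) (v i) - k i) (m i) := rfl

/-- The partition `k` below both `m` and `v` that corresponds to `l` above both. -/
noncomputable def toggleDown (m v l : ℕ →₀ ℕ) : ℕ →₀ ℕ :=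
  Finsupp.onFinset m.support
    (fun i => min (max (m (i + 1)) (v (i + 1)) + min (m i) (v i) - l (i + 1)) (m i)) (by
    intro i hi
    rw [Finsupp.mem_support_iff]
    intro h
    simp [h] at hi)

theorem toggleDown_apply (m v l : ℕ →₀ ℕ) (i : ℕ) :
    toggleDown m v l i =
      min (max (m (i + 1)) (v (i + 1)) + min (m i) (v i) - l (i + 1)) (m i) := rfl

/-- The local rule: partitions above both `m` and `v` correspond to pairs of a natural number
and a partition below both. -/
noncomputable def toggleEquiv (m v : ℕ →₀ ℕ) :
    {l // Interlaces l m ∧ Interlaces l v} ≃ ℕ × {k // Interlaces m k ∧ Interlaces v k} where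
  toFun l := (l.1 0 - max (m 0) (v 0), ⟨toggleDown m v l.1, by
    obtain ⟨l, hm, hv⟩ := l
    constructor <;> intro i <;> rw [toggleDown_apply] <;>
      have := hm i <;> have := hv i <;> have := hm (i + 1) <;> have := hv (i + 1) <;> dsimp only <;>
      omega⟩)
  invFun p := ⟨toggleUp m v p.1 p.2.1, by
    obtain ⟨n, k, hm, hv⟩ := p
    constructor <;> rintro (_ | i) <;> simp only [toggleUp_zero, toggleUp_succ]
    · have := hm 0; have := hv 0; omega
    · have := hm i; have := hv i; have := hm (i + 1); have := hv (i + 1); omega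
    · have := hm 0; have := hv 0; omega
    · have := hm i; have := hv i; have := hm (i + 1); have := hv (i + 1); omega⟩
  left_inv := by
    rintro ⟨l, hm, hv⟩
    ext i
    cases i with
    | zero => have := hm 0; have := hv 0; simp only [toggleUp_zero]; omega
    | succ i =>
      have := hm i; have := hv i; have := hm (i + 1); have := hv (i + 1)
      simp only [toggleUp_succ, toggleDown_apply]
      omega
  right_inv := by
    rintro ⟨n, k, hm, hv⟩
    refine Prod.ext ?_ (Subtype.ext (Finsupp.ext fun i => ?_))
    · simp only [toggleUp_zero]; omega
    · have := hm i; have := hv i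
      simp only [toggleUp_succ, toggleDown_apply]
      omega

theorem degree_toggleUp {m v k : ℕ →₀ ℕ} (n : ℕ) (hm : Interlaces m k) (hv : Interlaces v k) :
    (toggleUp m v n k).degree + k.degree = m.degree + v.degree + n := by
  obtain ⟨B, hB⟩ : ∃ B, ∀ i, B ≤ i → m i = 0 ∧ v i = 0 := by
    obtain ⟨B, hB⟩ := (m.support ∪ v.support).exists_nat_subset_range
    refine ⟨B, fun i hi => ?_⟩
    have : i ∉ m.support ∪ v.support := fun h =>
      (Finset.mem_range.1 (hB h)).not_ge hi
    simpa using this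
  have key : ∀ f : ℕ →₀ ℕ, (∀ i, B + 1 ≤ i → f i = 0) →
      f.degree = ∑ i ∈ Finset.range (B + 1), f i := by
    intro f hf
    refine Finsupp.degree_eq_sum_range fun i hi => ?_
    rw [Finset.mem_range]
    by_contra h
    exact Finsupp.mem_support_iff.1 hi (hf i (by omega))
  rw [key (toggleUp m v n k), key k, key m, key v, Finset.sum_range_succ', toggleUp_zero,
    Finset.sum_range_succ k, Finset.sum_range_succ m, Finset.sum_range_succ v]
  · have h1 : ∑ i ∈ Finset.range B, toggleUp m v n k (i + 1) + ∑ i ∈ Finset.range B, k i =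
        ∑ i ∈ Finset.range B, max (m (i + 1)) (v (i + 1)) +
          ∑ i ∈ Finset.range B, min (m i) (v i) := by
      rw [← Finset.sum_add_distrib, ← Finset.sum_add_distrib]
      refine Finset.sum_congr rfl fun i _ => ?_
      have := hm i; have := hv i
      rw [toggleUp_succ]; omega
    have h2 : ∑ i ∈ Finset.range B, max (m (i + 1)) (v (i + 1)) + max (m 0) (v 0) =
        ∑ i ∈ Finset.range B, max (m i) (v i) := by
      rw [← Finset.sum_range_succ' (fun i => max (m i) (v i)), Finset.sum_range_succ]
      simp [hB B le_rfl]
    have h3 : ∑ i ∈ Finset.range B, max (m i) (v i) + ∑ i ∈ Finset.range B, min (m i) (v i) =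
        ∑ i ∈ Finset.range B, m i + ∑ i ∈ Finset.range B, v i := by
      rw [← Finset.sum_add_distrib, ← Finset.sum_add_distrib]
      exact Finset.sum_congr rfl fun i _ => max_add_min _ _
    have h4 := hm B
    have h5 := hB B le_rfl
    omega
  · exact fun i hi => (hB i (by omega)).2
  · exact fun i hi => (hB i (by omega)).1
  · intro i hi
    have := hm i
    have := hB i (by omega)
    omega
  · rintro (_ | i) hi
    · omega
    · rw [toggleUp_succ, (hB i (by omega)).1]; simp

theorem ENNReal.tsum_mul_eq_tsum_subtype {α : Type*} (f : α → ℝ≥0∞) (P : α → Prop) (g : α → ℝ≥0∞)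
    (hP : ∀ a, P a → g a = 1) (hP' : ∀ a, ¬ P a → g a = 0) :
    ∑' a, g a * f a = ∑' a : {a // P a}, f a := by
  classical
  rw [show (∑' a : {a // P a}, f a) = ∑' a, Set.indicator {a | P a} f a from
    tsum_subtype {a | P a} f]
  refine tsum_congr fun a => ?_
  by_cases h : P a
  · simp [h, hP]
  · simp [h, hP']

/-- The commutation relation between the two transfer operators. -/
theorem tsum_interlaceInd_up (y : ℝ≥0∞) (m v : ℕ →₀ ℕ) :
    ∑' l, interlaceInd l m * interlaceInd l v * y ^ (l.degree - v.degree) =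
      (1 - y)⁻¹ * ∑' k, interlaceInd m k * interlaceInd v k * y ^ (m.degree - k.degree) := by
  have aux : ∀ a b c d : ℕ →₀ ℕ, ¬ (Interlaces a b ∧ Interlaces c d) →
      interlaceInd a b * interlaceInd c d = 0 := by
    intro a b c d h
    rcases not_and_or.1 h with h | h <;> simp [interlaceInd_of_not h]
  rw [ENNReal.tsum_mul_eq_tsum_subtype _ (fun l => Interlaces l m ∧ Interlaces l v) _
      (fun l h => by simp [interlaceInd_of h.1, interlaceInd_of h.2]) (fun l => aux _ _ _ _),
    ENNReal.tsum_mul_eq_tsum_subtype _ (fun k => Interlaces m k ∧ Interlaces v k) _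
      (fun l h => by simp [interlaceInd_of h.1, interlaceInd_of h.2]) (fun l => aux _ _ _ _),
    ← (toggleEquiv m v).symm.tsum_eq, ENNReal.tsum_prod', ← ENNReal.tsum_geometric,
    ← ENNReal.tsum_mul_right]
  refine tsum_congr fun n => ?_
  rw [← ENNReal.tsum_mul_left]
  refine tsum_congr fun ⟨k, hm, hv⟩ => ?_
  rw [← pow_add]
  congr 1
  have h1 := degree_toggleUp n hm hv
  have h2 := hm.degree_le
  change (toggleUp m v n k).degree - _ = n + (m.degree - k.degree)
  omega

/-- The generating function of sequences `l ≻ l₁ ≻ l₂ ≻ ⋯ ≻ l_N = 0` of interlacing partitions,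
by the total size of `l₁, …, l_N`. -/
noncomputable def chainSum (s : ℝ≥0∞) : ℕ → (ℕ →₀ ℕ) → ℝ≥0∞
  | 0, l => if l = 0 then 1 else 0
  | N + 1, l => ∑' m, interlaceInd l m * (s ^ m.degree * chainSum s N m)

theorem chainSum_zero_right (s : ℝ≥0∞) (N : ℕ) : chainSum s N 0 = 1 := by
  induction N with
  | zero => simp [chainSum]
  | succ N ih =>
    rw [chainSum, tsum_eq_single 0]
    · rw [interlaceInd_of (fun i => by simp)]
      simp [ih]
    · intro m hm
      rw [interlaceInd_of_not fun h => hm h.eq_zero, zero_mul]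

/-- `chainSum` is an eigenvector of the transfer operator. -/
theorem tsum_interlaceInd_mul_chainSum (s y : ℝ≥0∞) (N : ℕ) (v : ℕ →₀ ℕ) :
    ∑' l, interlaceInd l v * y ^ (l.degree - v.degree) * chainSum s N l =
      (∏ i ∈ Finset.range N, (1 - y * s ^ i)⁻¹) * chainSum s N v := by
  induction N generalizing y v with
  | zero =>
    rw [tsum_eq_single 0]
    · by_cases hv : v = 0
      · subst hv
        rw [interlaceInd_of (fun i => by simp)]
        simp [chainSum]
      · rw [interlaceInd_of_not fun h => hv h.eq_zero]
        simp [chainSum, hv]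
    · intro l hl
      simp [chainSum, hl]
  | succ N ih =>
    calc
      _ = ∑' m, s ^ m.degree * chainSum s N m *
            ∑' l, interlaceInd l m * interlaceInd l v * y ^ (l.degree - v.degree) := by
        simp only [chainSum, ← ENNReal.tsum_mul_left]
        rw [ENNReal.tsum_comm]
        refine tsum_congr fun m => tsum_congr fun l => by ring
      _ = (1 - y)⁻¹ * ∑' k, interlaceInd v k * (s ^ k.degree *
            ∑' m, interlaceInd m k * (y * s) ^ (m.degree - k.degree) * chainSum s N m) := by
        simp only [tsum_interlaceInd_up, ← ENNReal.tsum_mul_left]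
        rw [ENNReal.tsum_comm]
        refine tsum_congr fun k => tsum_congr fun m => ?_
        by_cases h : Interlaces m k
        · have : s ^ m.degree = s ^ k.degree * s ^ (m.degree - k.degree) := by
            rw [← pow_add, Nat.add_sub_cancel' h.degree_le]
          rw [this, mul_pow]
          ring
        · simp [interlaceInd_of_not h]
      _ = _ := by
        simp only [ih, chainSum, ← ENNReal.tsum_mul_left, Finset.prod_range_succ']
        refine tsum_congr fun k => ?_
        simp only [pow_succ', pow_zero, mul_one, mul_assoc]
        ring

/-- The Cauchy identity for principal specializations. -/
theorem tsum_chainSum_mul_chainSum (s c : ℝ≥0∞) (M N : ℕ) :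
    ∑' l : ℕ →₀ ℕ, c ^ l.degree * (chainSum s M l * chainSum s N l) =
      ∏ j ∈ Finset.range N, ∏ i ∈ Finset.range M, (1 - c * s ^ (i + j))⁻¹ := by
  induction N generalizing c with
  | zero =>
    rw [tsum_eq_single 0 fun l hl => by simp [chainSum, hl]]
    simp [chainSum_zero_right]
  | succ N ih =>
    calc
      _ = ∑' m : ℕ →₀ ℕ, (c * s) ^ m.degree * chainSum s N m *
            ∑' l, interlaceInd l m * c ^ (l.degree - m.degree) * chainSum s M l := by
        simp only [chainSum, ← ENNReal.tsum_mul_left]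
        rw [ENNReal.tsum_comm]
        refine tsum_congr fun m => tsum_congr fun l => ?_
        by_cases h : Interlaces l m
        · have : c ^ l.degree = c ^ m.degree * c ^ (l.degree - m.degree) := by
            rw [← pow_add, Nat.add_sub_cancel' h.degree_le]
          rw [this, mul_pow]
          ring
        · simp [interlaceInd_of_not h]
      _ = (∏ i ∈ Finset.range M, (1 - c * s ^ i)⁻¹) *
            ∑' m : ℕ →₀ ℕ, (c * s) ^ m.degree * (chainSum s M m * chainSum s N m) := by
        simp only [tsum_interlaceInd_mul_chainSum, ← ENNReal.tsum_mul_left]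
        refine tsum_congr fun m => by ring
      _ = _ := by
        rw [ih, Finset.prod_range_succ', mul_comm]
        simp only [add_zero, mul_assoc, ← pow_succ', add_assoc]

/-- Sequences `l = c 0 ≻ c 1 ≻ ⋯ ≻ c N = 0` of interlacing partitions. -/
def InterlacingChain (N : ℕ) (l : ℕ →₀ ℕ) : Type :=
  {c : ℕ → ℕ →₀ ℕ // c 0 = l ∧ c N = 0 ∧ ∀ k, Interlaces (c k) (c (k + 1))}

namespace InterlacingChain

theorem eq_zero {N : ℕ} {l : ℕ →₀ ℕ} (c : InterlacingChain N l) {k : ℕ} (hk : N ≤ k) :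
    c.1 k = 0 := by
  induction k, hk using Nat.le_induction with
  | base => exact c.2.2.1
  | succ k _ ih =>
    have := c.2.2.2 k
    rw [ih] at this
    exact this.eq_zero

/-- The total size of all members of a chain but the first. -/
noncomputable def tailSize {N : ℕ} {l : ℕ →₀ ℕ} (c : InterlacingChain N l) : ℕ :=
  ∑ k ∈ Finset.range N, (c.1 (k + 1)).degree

/-- Removing the first member of a chain. -/
def succEquiv (N : ℕ) (l : ℕ →₀ ℕ) :
    InterlacingChain (N + 1) l ≃ Σ m : {m // Interlaces l m}, InterlacingChain N m where
  toFun c := ⟨⟨c.1 1, by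
    simpa only [c.2.1] using c.2.2.2 0⟩, ⟨fun k => c.1 (k + 1), rfl, c.2.2.1, fun k => c.2.2.2 _⟩⟩
  invFun d := ⟨fun k => match k with
      | 0 => l
      | k + 1 => d.2.1 k, rfl, d.2.2.2.1, fun k => by
    rcases k with _ | k
    · simpa only [d.2.2.1] using d.1.2
    · exact d.2.2.2.2 k⟩
  left_inv := by
    rintro ⟨c, rfl, hN, hc⟩
    refine Subtype.ext (funext fun k => ?_)
    cases k <;> rfl
  right_inv := by
    rintro ⟨⟨m, hm⟩, d, h₀, hN, hd⟩
    change d 0 = m at h₀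
    subst h₀
    rfl

theorem tsum_pow_tailSize (s : ℝ≥0∞) (N : ℕ) (l : ℕ →₀ ℕ) :
    ∑' c : InterlacingChain N l, s ^ c.tailSize = chainSum s N l := by
  induction N generalizing l with
  | zero =>
    by_cases hl : l = 0
    · subst hl
      let c₀ : InterlacingChain 0 0 := ⟨fun _ => 0, rfl, rfl, fun _ i => by simp⟩
      rw [tsum_eq_single c₀]
      · simp [chainSum, tailSize]
      · intro c hc
        exact absurd (Subtype.ext (funext fun k => c.eq_zero (Nat.zero_le k))) hc
    · have : IsEmpty (InterlacingChain 0 l) := ⟨fun c => hl (c.2.1.symm.trans c.2.2.1)⟩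
      simp [chainSum, hl]
  | succ N ih =>
    rw [chainSum, ENNReal.tsum_mul_eq_tsum_subtype _ (Interlaces l) _
      (fun m h => interlaceInd_of h) (fun m h => interlaceInd_of_not h),
      ← (succEquiv N l).symm.tsum_eq, ENNReal.tsum_sigma']
    refine tsum_congr fun m => ?_
    rw [← ih, ← ENNReal.tsum_mul_left]
    refine tsum_congr fun d => ?_
    rw [← pow_add]
    congr 1
    refine (Finset.sum_range_succ' _ N).trans ((add_comm _ _).trans ?_)
    exact congrArg (fun m : ℕ →₀ ℕ => m.degree + d.tailSize) d.2.1

theorem sigma_ext {N : ℕ} {c d : Σ l : ℕ →₀ ℕ, InterlacingChain N l × InterlacingChain N l}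
    (h₁ : c.2.1.1 = d.2.1.1) (h₂ : c.2.2.1 = d.2.2.1) : c = d := by
  obtain ⟨_, ⟨a, rfl, ha⟩, b, hb⟩ := c
  obtain ⟨_, ⟨a', rfl, ha'⟩, b', hb'⟩ := d
  obtain rfl : a = a' := h₁
  obtain rfl : b = b' := h₂
  rfl

end InterlacingChain

namespace PlanePartition

@[ext]
theorem ext {π ρ : PlanePartition} (h : ∀ i j, π.part i j = ρ.part i j) : π = ρ := by
  cases π; cases ρ
  congr
  exact funext fun i => funext fun j => h i j

/-- The `k`-th diagonal of `π` below the main one. -/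
noncomputable def lowerDiag (π : PlanePartition) (k : ℕ) : ℕ →₀ ℕ :=
  Finsupp.ofSupportFinite (fun i => π.part (i + k) i)
    (π.finite_supp.preimage (f := fun i => (i + k, i)) fun _ _ _ _ h => (Prod.ext_iff.1 h).2)

/-- The `k`-th diagonal of `π` above the main one. -/
noncomputable def upperDiag (π : PlanePartition) (k : ℕ) : ℕ →₀ ℕ :=
  Finsupp.ofSupportFinite (fun i => π.part i (i + k))
    (π.finite_supp.preimage (f := fun i => (i, i + k)) fun _ _ _ _ h => (Prod.ext_iff.1 h).1)

@[simp]
theorem lowerDiag_apply (π : PlanePartition) (k i : ℕ) : π.lowerDiag k i = π.part (i + k) i := rfl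

@[simp]
theorem upperDiag_apply (π : PlanePartition) (k i : ℕ) : π.upperDiag k i = π.part i (i + k) := rfl

/-- `π` vanishes on the `N`-th diagonals on both sides of the main one. -/
def IsBounded (π : PlanePartition) (N : ℕ) : Prop := π.lowerDiag N = 0 ∧ π.upperDiag N = 0

/-- The chain of the diagonals of `π` from the main one downwards. -/
noncomputable def lowerChain (π : PlanePartition) {N : ℕ} (h : π.IsBounded N) :
    InterlacingChain N (π.lowerDiag 0) :=
  ⟨π.lowerDiag, rfl, h.1, fun k i => ⟨π.col_decr _ _, by
    simpa [add_right_comm, add_assoc] using π.row_decr (i + 1 + k) i⟩⟩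

/-- The chain of the diagonals of `π` from the main one upwards. -/
noncomputable def upperChain (π : PlanePartition) {N : ℕ} (h : π.IsBounded N) :
    InterlacingChain N (π.lowerDiag 0) :=
  ⟨π.upperDiag, rfl, h.2, fun k i => ⟨π.row_decr _ _, by
    simpa [add_right_comm, add_assoc] using π.col_decr i (i + 1 + k)⟩⟩

/-- The plane partition with given diagonals. -/
def ofChains {N : ℕ} {l : ℕ →₀ ℕ} (a b : InterlacingChain N l) : PlanePartition where
  part i j := if j ≤ i then a.1 (i - j) j else b.1 (j - i) i
  row_decr i j := by
    by_cases h : j + 1 ≤ i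
    · obtain ⟨k, rfl⟩ := Nat.exists_eq_add_of_le h
      have := (a.2.2.2 k j).2
      rw [if_pos (by omega), if_pos (by omega), show j + 1 + k - (j + 1) = k by omega,
        show j + 1 + k - j = k + 1 by omega]
      exact this
    · obtain ⟨k, rfl⟩ := Nat.exists_eq_add_of_le (show i ≤ j by omega)
      have := (b.2.2.2 k i).1
      rw [if_neg (by omega), show i + k + 1 - i = k + 1 by omega]
      split_ifs with h'
      · obtain rfl : k = 0 := by omega
        simpa [a.2.1, b.2.1] using this
      · rwa [show i + k - i = k by omega]
  col_decr i j := by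
    by_cases h : j ≤ i
    · obtain ⟨k, rfl⟩ := Nat.exists_eq_add_of_le h
      have := (a.2.2.2 k j).1
      rw [if_pos (by omega), if_pos (by omega), show j + k + 1 - j = k + 1 by omega,
        show j + k - j = k by omega]
      exact this
    · obtain ⟨k, rfl⟩ := Nat.exists_eq_add_of_le (show i + 1 ≤ j by omega)
      have := (b.2.2.2 k i).2
      rw [if_neg h, show i + 1 + k - i = k + 1 by omega]
      split_ifs with h'
      · obtain rfl : k = 0 := by omega
        simpa [a.2.1, b.2.1] using this
      · rwa [show i + 1 + k - (i + 1) = k by omega]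
  finite_supp := by
    let u : Finset ℕ := (Finset.range N).biUnion fun k => (a.1 k).support ∪ (b.1 k).support
    obtain ⟨B, hB⟩ := u.exists_nat_subset_range
    have hu : ∀ k i, a.1 k i ≠ 0 ∨ b.1 k i ≠ 0 → k < N ∧ i < B := by
      intro k i h
      have hk : k < N := by
        by_contra hk
        simp [a.eq_zero (not_lt.1 hk), b.eq_zero (not_lt.1 hk)] at h
      exact ⟨hk, Finset.mem_range.1 (hB (Finset.mem_biUnion.2 ⟨k, by simpa using hk,
        by simpa using h⟩))⟩
    refine ((Finset.range (B + N)) ×ˢ (Finset.range (B + N))).finite_toSet.subset ?_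
    rintro ⟨i, j⟩ h
    simp only [Set.mem_ofPred_eq] at h
    simp only [Finset.coe_product, Finset.coe_range, Set.mem_prod, Set.mem_Iio]
    split_ifs at h
    · have := hu _ _ (Or.inl h); omega
    · have := hu _ _ (Or.inr h); omega

theorem lowerDiag_ofChains {N : ℕ} {l : ℕ →₀ ℕ} (a b : InterlacingChain N l) :
    (ofChains a b).lowerDiag = a.1 := by
  ext k i
  simp [ofChains]

theorem upperDiag_ofChains {N : ℕ} {l : ℕ →₀ ℕ} (a b : InterlacingChain N l) :
    (ofChains a b).upperDiag = b.1 := by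
  ext k i
  rcases k with _ | k
  · simp [ofChains, a.2.1, b.2.1]
  · simp [ofChains]

/-- A plane partition is the same as two chains that start at the main diagonal. -/
noncomputable def chainsEquiv (N : ℕ) :
    {π : PlanePartition // π.IsBounded N} ≃
      Σ l : ℕ →₀ ℕ, InterlacingChain N l × InterlacingChain N l where
  toFun π := ⟨π.1.lowerDiag 0, π.1.lowerChain π.2, π.1.upperChain π.2⟩
  invFun c := ⟨ofChains c.2.1 c.2.2, by
    rw [IsBounded, lowerDiag_ofChains, upperDiag_ofChains]
    exact ⟨c.2.1.2.2.1, c.2.2.2.2.1⟩⟩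
  left_inv := by
    rintro ⟨π, h⟩
    ext i j
    by_cases hij : j ≤ i
    · simp [ofChains, hij, lowerChain]
    · simp [ofChains, hij, upperChain, Nat.add_sub_cancel' (not_le.1 hij).le]
  right_inv := by
    rintro ⟨l, a, b⟩
    exact InterlacingChain.sigma_ext (lowerDiag_ofChains a b) (upperDiag_ofChains a b)

/-- Boxes on, below and above the main diagonal. -/
def boxOfDiag : (ℕ ⊕ ℕ × ℕ) ⊕ ℕ × ℕ → ℕ × ℕ
  | .inl (.inl i) => (i, i)
  | .inl (.inr (k, i)) => (i + (k + 1), i)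
  | .inr (k, i) => (i, i + (k + 1))

theorem boxOfDiag_bijective : Function.Bijective boxOfDiag := by
  constructor
  · rintro ((i | ⟨k, i⟩) | ⟨k, i⟩) ((j | ⟨m, j⟩) | ⟨m, j⟩) h <;>
      simp only [boxOfDiag, Prod.mk.injEq, Sum.inl.injEq, Sum.inr.injEq, reduceCtorEq] at h ⊢ <;>
      omega
  · rintro ⟨i, j⟩
    rcases lt_trichotomy i j with h | rfl | h
    · exact ⟨.inr (j - i - 1, i), Prod.ext rfl (by simp only [boxOfDiag]; omega)⟩
    · exact ⟨.inl (.inl i), rfl⟩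
    · exact ⟨.inl (.inr (i - j - 1, j)), Prod.ext (by simp only [boxOfDiag]; omega) rfl⟩

theorem coe_weight (π : PlanePartition) :
    (π.weight : ℝ≥0∞) = ∑' p : ℕ × ℕ, (π.part p.1 p.2 : ℝ≥0∞) := by
  have h : (Function.support fun p : ℕ × ℕ => π.part p.1 p.2).Finite := π.finite_supp
  rw [weight, finsum_eq_sum _ h, Nat.cast_sum, tsum_eq_sum]
  intro p hp
  simpa using hp

theorem _root_.Finsupp.coe_degree_eq_tsum (f : ℕ →₀ ℕ) :
    (f.degree : ℝ≥0∞) = ∑' i, (f i : ℝ≥0∞) := by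
  rw [Finsupp.degree_apply, Nat.cast_sum, tsum_eq_sum]
  intro i hi
  simpa using hi

theorem _root_.InterlacingChain.coe_tailSize {N : ℕ} {l : ℕ →₀ ℕ} (c : InterlacingChain N l) :
    (c.tailSize : ℝ≥0∞) = ∑' p : ℕ × ℕ, (c.1 (p.1 + 1) p.2 : ℝ≥0∞) := by
  rw [ENNReal.tsum_prod', InterlacingChain.tailSize, Nat.cast_sum, tsum_eq_sum (s := Finset.range N)]
  · simp only [Finsupp.coe_degree_eq_tsum]
  · intro k hk
    rw [Finset.mem_range, not_lt] at hk
    simp [c.eq_zero (hk.trans k.le_succ)]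

theorem weight_eq (π : PlanePartition) {N : ℕ} (h : π.IsBounded N) :
    π.weight =
      (π.lowerDiag 0).degree + (π.lowerChain h).tailSize + (π.upperChain h).tailSize := by
  apply Nat.cast_injective (R := ℝ≥0∞)
  push_cast
  rw [coe_weight, Finsupp.coe_degree_eq_tsum, InterlacingChain.coe_tailSize,
    InterlacingChain.coe_tailSize, ← (Equiv.ofBijective _ boxOfDiag_bijective).tsum_eq,
    ENNReal.summable.tsum_sum ENNReal.summable, ENNReal.summable.tsum_sum ENNReal.summable]
  rfl

theorem tsum_bounded (s : ℝ≥0∞) (N : ℕ) :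
    ∑' π : {π : PlanePartition // π.IsBounded N}, s ^ π.1.weight =
      ∏ p ∈ Finset.range N ×ˢ Finset.range N, (1 - s ^ (p.1 + p.2 + 1))⁻¹ := by
  have h : ∀ π : {π : PlanePartition // π.IsBounded N}, s ^ π.1.weight =
      s ^ (chainsEquiv N π).1.degree *
        (s ^ (chainsEquiv N π).2.1.tailSize * s ^ (chainsEquiv N π).2.2.tailSize) := by
    intro π
    rw [weight_eq π.1 π.2, pow_add, pow_add, mul_assoc]
    rfl
  rw [tsum_congr h, (chainsEquiv N).tsum_eq (fun c => s ^ c.1.degree *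
    (s ^ c.2.1.tailSize * s ^ c.2.2.tailSize)), ENNReal.tsum_sigma', Finset.prod_product_right]
  simp only [ENNReal.tsum_mul_left, ENNReal.tsum_prod', ENNReal.tsum_mul_right,
    InterlacingChain.tsum_pow_tailSize, tsum_chainSum_mul_chainSum, pow_succ']

theorem exists_isBounded (π : PlanePartition) : ∃ N₀, ∀ N, N₀ ≤ N → π.IsBounded N := by
  obtain ⟨B, hB⟩ := (π.finite_supp.toFinset.image fun p => p.1 + p.2).exists_nat_subset_range
  have key : ∀ i j, B ≤ i + j → π.part i j = 0 := by
    intro i j h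
    by_contra hne
    exact (Finset.mem_range.1 (hB (Finset.mem_image.2 ⟨(i, j), by simpa using hne, rfl⟩))).not_ge h
  refine ⟨B, fun N hN => ⟨Finsupp.ext fun i => ?_, Finsupp.ext fun i => ?_⟩⟩
  · exact key _ _ (by omega)
  · exact key _ _ (by omega)

theorem tsum_eq_iSup_bounded (f : PlanePartition → ℝ≥0∞) :
    ∑' π, f π = ⨆ N, ∑' π : {π : PlanePartition // π.IsBounded N}, f π := by
  refine le_antisymm ?_ (iSup_le fun N =>
    ENNReal.tsum_comp_le_tsum_of_injective Subtype.val_injective f)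
  rw [ENNReal.tsum_eq_iSup_sum]
  refine iSup_le fun t => ?_
  choose N₀ hN₀ using exists_isBounded
  refine le_trans ?_ (le_iSup _ (t.sup N₀))
  rw [show (∑' π : {π : PlanePartition // π.IsBounded (t.sup N₀)}, f π) =
    ∑' π, Set.indicator {π | π.IsBounded (t.sup N₀)} f π from tsum_subtype _ f]
  refine le_trans (le_of_eq ?_) (ENNReal.sum_le_tsum t)
  exact Finset.sum_congr rfl fun π hπ =>
    (Set.indicator_of_mem (s := {π : PlanePartition | π.IsBounded (t.sup N₀)})
      (hN₀ π _ (Finset.le_sup hπ)) f).symm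

end PlanePartition

theorem multipliable_inv_one_sub_pow_add {s : ℝ} (hs0 : 0 ≤ s) (hs1 : s < 1) :
    Multipliable fun p : ℕ × ℕ => (1 - s ^ (p.1 + p.2 + 1))⁻¹ := by
  have hlt : ∀ n, s ^ (n + 1) ≤ s := fun n => by
    simpa using pow_le_pow_of_le_one hs0 hs1.le (Nat.le_add_left 1 n)
  have hpos : ∀ n, 0 < 1 - s ^ (n + 1) := fun n => by linarith [hlt n]
  refine Real.multipliable_of_summable_log (fun p => inv_pos.2 (hpos _)) ?_
  have hg := summable_geometric_of_lt_one hs0 hs1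
  refine Summable.of_nonneg_of_le (fun p => ?_) (fun p => ?_)
    ((hg.mul_of_nonneg hg (fun n => pow_nonneg hs0 n) (fun n => pow_nonneg hs0 n)).mul_right
      (s * (1 - s)⁻¹))
  · exact Real.log_nonneg ((one_le_inv₀ (hpos _)).2 (by linarith [pow_nonneg hs0 (p.1 + p.2 + 1)]))
  · refine (Real.log_le_sub_one_of_pos (inv_pos.2 (hpos _))).trans ?_
    have h1 : (1 - s ^ (p.1 + p.2 + 1))⁻¹ - 1 =
        s ^ (p.1 + p.2 + 1) * (1 - s ^ (p.1 + p.2 + 1))⁻¹ := by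
      have := (hpos (p.1 + p.2)).ne'
      field_simp
      ring
    rw [h1, ← mul_assoc, ← pow_add, ← pow_succ]
    exact mul_le_mul_of_nonneg_left
      (inv_anti₀ (by linarith) (by linarith [hlt (p.1 + p.2)])) (pow_nonneg hs0 _)

theorem tprod_inv_one_sub_pow_add {s : ℝ} (hs0 : 0 ≤ s) (hs1 : s < 1) :
    ∏' p : ℕ × ℕ, (1 - s ^ (p.1 + p.2 + 1))⁻¹ = ∏' n : ℕ, (1 / (1 - s ^ (n + 1))) ^ (n + 1) := by
  have hm := multipliable_inv_one_sub_pow_add hs0 hs1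
  rw [← Finset.HasAntidiagonal.sigmaAntidiagonalEquivProd.tprod_eq]
  refine (Multipliable.tprod_sigma' (fun n => (hasProd_fintype _).multipliable)
    (Finset.HasAntidiagonal.sigmaAntidiagonalEquivProd.multipliable_iff.2 hm)).trans ?_
  refine tprod_congr fun n => ?_
  rw [tprod_fintype, Finset.prod_congr rfl (g := fun _ => 1 / (1 - s ^ (n + 1)))]
  · simp
  · rintro ⟨p, hp⟩ -
    simp [Finset.HasAntidiagonal.mem_antidiagonal.1 hp]

theorem PlanePartition.tsum_ofReal_pow_weight {s : ℝ} (hs0 : 0 ≤ s) (hs1 : s < 1) :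
    ∑' π : PlanePartition, ENNReal.ofReal s ^ π.weight =
      ENNReal.ofReal (∏' p : ℕ × ℕ, (1 - s ^ (p.1 + p.2 + 1))⁻¹) := by
  have hmono : Monotone fun N : ℕ => Finset.range N ×ˢ Finset.range N := fun M N h =>
    Finset.product_subset_product (Finset.range_mono h) (Finset.range_mono h)
  have hlim := (multipliable_inv_one_sub_pow_add hs0 hs1).hasProd.comp
    (Filter.tendsto_atTop_finset_of_monotone hmono fun p => ⟨p.1 + p.2 + 1, by
      simp only [Finset.mem_product, Finset.mem_range]; omega⟩)
  rw [tsum_eq_iSup_bounded]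
  simp only [tsum_bounded]
  refine tendsto_nhds_unique (tendsto_atTop_iSup fun M N h =>
    Finset.prod_le_prod_of_subset_of_one_le' (hmono h) fun p _ _ =>
      ENNReal.one_le_inv.2 tsub_le_self) ?_
  refine (ENNReal.tendsto_ofReal hlim).congr fun N => ?_
  have hpos : ∀ n, 0 < 1 - s ^ (n + 1) := fun n =>
    sub_pos.2 (pow_lt_one₀ hs0 hs1 n.succ_ne_zero)
  simp only [Function.comp_apply]
  rw [ENNReal.ofReal_prod_of_nonneg fun p _ => (inv_pos.2 (hpos _)).le]
  refine Finset.prod_congr rfl fun p _ => ?_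
  rw [ENNReal.ofReal_inv_of_pos (hpos _), ENNReal.ofReal_sub _ (pow_nonneg hs0 _),
    ENNReal.ofReal_one, ENNReal.ofReal_pow hs0]

end MacMahon

/-- **MacMahon's formula.**
`∑_{π ∈ P} s^{|π|} = ∏_{n=1}^{∞} (1 / (1 - sⁿ))ⁿ`, the sum being over all
plane partitions, for real `0 ≤ s < 1`. -/
theorem macmahon (s : ℝ) (hs0 : 0 ≤ s) (hs1 : s < 1) :
    ∑' π : PlanePartition, s ^ π.weight =
      ∏' n : ℕ, (1 / (1 - s ^ (n + 1))) ^ (n + 1) := by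
  rw [← tprod_inv_one_sub_pow_add hs0 hs1]
  have h := congrArg ENNReal.toReal (PlanePartition.tsum_ofReal_pow_weight hs0 hs1)
  rw [ENNReal.tsum_toReal_eq fun π => ENNReal.pow_ne_top ENNReal.ofReal_ne_top,
    ENNReal.toReal_ofReal (tprod_nonneg fun p =>
      inv_nonneg.2 (sub_nonneg.2 (pow_le_one₀ hs0 hs1.le)))] at h
  simpa [ENNReal.toReal_ofReal hs0] using h
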